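/- Let T ∈ (0,∞] and let (u,p) be a smooth solution of the incompressible Navier–Stokes/Euler equations on [0,T) with μ = 0 (the Euler case), such that u vanishes at spatial infinity. Fix t ∈ [0,T) and suppose the zero-vorticity set Ω_t is not all of ℝ³. Then the supremum over x ∈ ℝ³ of ‖u(t,x)‖ equals the supremum over x in the closure of ℝ³ \ Ω_t of ‖u(t,x)‖. -/

import Mathlib

noncomputable section

open Set Filter Topology
open scoped ENNReal RealInnerProductSpace

abbrev E3 : Type := EuclideanSpace ℝ (Fin 3)

/-- The `i`-th standard basis vector of `ℝ³`. -/
def ee (i : Fin 3) : E3 := EuclideanSpace.single i 1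

/-- Partial derivative in the `i`-th coordinate direction. -/
def pd {F : Type*} [NormedAddCommGroup F] [NormedSpace ℝ F]
    (i : Fin 3) (f : E3 → F) (x : E3) : F :=
  fderiv ℝ f x (ee i)

/-- Divergence of a vector field on `ℝ³`. -/
def div3 (v : E3 → E3) (x : E3) : ℝ := ∑ i, pd i v x i

/-- Componentwise Laplacian of a vector field on `ℝ³`. -/
def lapVec (v : E3 → E3) (x : E3) : E3 := ∑ i, pd i (fun y => pd i v y) x

/-- Laplacian of a scalar function on `ℝ³`. -/
def lapSc (f : E3 → ℝ) (x : E3) : ℝ := ∑ i, pd i (fun y => pd i f y) x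

/-- Curl of a vector field on `ℝ³`. -/
def curl3 (v : E3 → E3) (x : E3) : E3 :=
  (WithLp.equiv 2 (Fin 3 → ℝ)).symm
    ![pd 1 v x 2 - pd 2 v x 1, pd 2 v x 0 - pd 0 v x 2, pd 0 v x 1 - pd 1 v x 0]

/-- Cross product on `ℝ³`. -/
def cross3 (a b : E3) : E3 :=
  (WithLp.equiv 2 (Fin 3 → ℝ)).symm
    (crossProduct ((WithLp.equiv 2 (Fin 3 → ℝ)) a) ((WithLp.equiv 2 (Fin 3 → ℝ)) b))

/-- The time interval `[0, T)`, where `T ∈ (0, ∞]`. -/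
def TimeDom (T : ℝ≥0∞) : Set ℝ := {t : ℝ | 0 ≤ t ∧ ENNReal.ofReal t < T}

/-- `(u, p)` is a smooth solution of the incompressible Navier–Stokes (`μ > 0`) / Euler
(`μ = 0`) equations on `ℝ³ × [0, T)`:  `u, p` are smooth in `(t, x)` and satisfy pointwise
`∂ₜ u + (u·∇)u − μ Δu + ∇p = 0` and `div u = 0`. -/
def IsNSSolution (μ : ℝ) (T : ℝ≥0∞) (u : ℝ → E3 → E3) (p : ℝ → E3 → ℝ) : Prop :=
  ContDiffOn ℝ (⊤ : ℕ∞) (fun q : ℝ × E3 => u q.1 q.2) (TimeDom T ×ˢ (univ : Set E3)) ∧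
  ContDiffOn ℝ (⊤ : ℕ∞) (fun q : ℝ × E3 => p q.1 q.2) (TimeDom T ×ˢ (univ : Set E3)) ∧
  (∀ t ∈ TimeDom T, ∀ x : E3,
    deriv (fun s => u s x) t + fderiv ℝ (u t) x (u t x)
      - μ • lapVec (u t) x + gradient (p t) x = 0) ∧
  (∀ t ∈ TimeDom T, ∀ x : E3, div3 (u t) x = 0)
/-- Second derivative test at a local maximum. -/
lemma second_deriv_nonpos_of_isLocalMax (h h1 : ℝ → ℝ) (c : ℝ)
    (hd : ∀ s, HasDerivAt h (h1 s) s) (hd2 : HasDerivAt h1 c 0)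
    (hmax : IsLocalMax h 0) : c ≤ 0 := by
  by_contra hc
  push Not at hc
  have e1 : deriv h = h1 := funext fun s => (hd s).deriv
  have hmin : IsLocalMin h 0 := by
    apply isLocalMin_of_deriv_deriv_pos
    · rw [e1, hd2.deriv]; exact hc
    · exact hmax.deriv_eq_zero
    · exact (hd 0).continuousAt
  have hconst : h =ᶠ[𝓝 0] fun _ => h 0 := by
    filter_upwards [hmin, hmax] with s a b using le_antisymm b a
  have h1z : h1 =ᶠ[𝓝 0] fun _ => 0 := by
    have := hconst.deriv
    rw [e1] at this
    simpa using this
  have := hd2.deriv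
  rw [h1z.deriv_eq] at this
  simp at this
  linarith

/-- Second derivative of a regularised linear component at a local maximum. -/
lemma second_dir_le (v : E3 → E3) (hv : ContDiff ℝ 2 v) (e x w : E3) (ε : ℝ)
    (hmax : IsLocalMax (fun y => ⟪v y, e⟫ + ε * ⟪y, y⟫) x) :
    ⟪fderiv ℝ (fderiv ℝ v) x w w, e⟫ + ε * (2 * ⟪w, w⟫) ≤ 0 := by
  have hl : ∀ s : ℝ, HasDerivAt (fun s : ℝ => x + s • w) w s := fun s => by
    simpa using ((hasDerivAt_id s).smul_const w).const_add x
  have hvd : Differentiable ℝ v := hv.differentiable (by norm_num)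
  have hDd : Differentiable ℝ (fderiv ℝ v) :=
    (hv.fderiv_right (m := 1) (by norm_num)).differentiable (by norm_num)
  refine second_deriv_nonpos_of_isLocalMax
    (fun s => ⟪v (x + s • w), e⟫ + ε * ⟪x + s • w, x + s • w⟫)
    (fun s => ⟪fderiv ℝ v (x + s • w) w, e⟫ + ε * (2 * ⟪x + s • w, w⟫)) _ ?_ ?_ ?_
  · intro s
    have a := ((hvd (x + s • w)).hasFDerivAt.comp_hasDerivAt s (hl s)).inner ℝ
      (hasDerivAt_const s e)
    have b := ((hl s).inner ℝ (hl s)).const_mul ε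
    refine (a.add b).congr_deriv ?_
    rw [real_inner_comm (x + s • w) w, inner_zero_right]
    ring
  · have hDx := (hDd (x + (0:ℝ) • w)).hasFDerivAt.comp_hasDerivAt 0 (hl 0)
    have a := (hDx.clm_apply (hasDerivAt_const (0:ℝ) w)).inner ℝ (hasDerivAt_const (0:ℝ) e)
    have b := (((hl 0).inner ℝ (hasDerivAt_const (0:ℝ) w)).const_mul 2).const_mul ε
    refine (a.add b).congr_deriv ?_
    simp
  · have hc : Tendsto (fun s : ℝ => x + s • w) (𝓝 0) (𝓝 x) := by
      have := (hl 0).continuousAt.tendsto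
      simpa using this
    have := hc.eventually hmax
    simpa [IsLocalMax, IsMaxFilter] using this

/-- A curl- and divergence-free field is harmonic. -/
lemma lap_zero (v : E3 → E3) (hv : ContDiff ℝ 2 v) (x : E3)
    (hdiv : ∀ y, div3 v y = 0) (hcurl : ∀ᶠ y in 𝓝 x, curl3 v y = 0) :
    ∑ i, fderiv ℝ (fderiv ℝ v) x (ee i) (ee i) = 0 := by
  have hDd : DifferentiableAt ℝ (fderiv ℝ v) x :=
    (hv.fderiv_right (m := 1) (by norm_num)).differentiable (by norm_num) x
  have hcomp : ∀ i j : Fin 3, HasFDerivAt (fun y => fderiv ℝ v y (ee i) j)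
      ((EuclideanSpace.proj j : E3 →L[ℝ] ℝ).comp
        ((fderiv ℝ (fderiv ℝ v) x).flip (ee i))) x := by
    intro i j
    have a := hDd.hasFDerivAt.clm_apply (hasFDerivAt_const (ee i) x)
    have b := (EuclideanSpace.proj j : E3 →L[ℝ] ℝ).hasFDerivAt.comp x a
    refine b.congr_fderiv ?_
    ext w
    simp
  have hsymm : ∀ a b, fderiv ℝ (fderiv ℝ v) x a b = fderiv ℝ (fderiv ℝ v) x b a :=
    fun a b => (hv.contDiffAt.isSymmSndFDerivAt (by simp)) a b
  have hsw : ∀ i j : Fin 3, ∀ᶠ y in 𝓝 x, fderiv ℝ v y (ee i) j = fderiv ℝ v y (ee j) i := by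
    intro i j
    filter_upwards [hcurl] with y hy
    have h0 := congrArg (fun z : E3 => z 0) hy
    have h1 := congrArg (fun z : E3 => z 1) hy
    have h2 := congrArg (fun z : E3 => z 2) hy
    simp [curl3, pd] at h0 h1 h2
    fin_cases i <;> fin_cases j <;> simp <;> linarith
  have hsw2 : ∀ i j : Fin 3, ∀ w, fderiv ℝ (fderiv ℝ v) x w (ee i) j
      = fderiv ℝ (fderiv ℝ v) x w (ee j) i := by
    intro i j w
    have := (hcomp i j).unique ((hcomp j i).congr_of_eventuallyEq (hsw i j))
    simpa using congrArg (fun L : E3 →L[ℝ] ℝ => L w) this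
  have hdv : ∀ w, ∑ i, fderiv ℝ (fderiv ℝ v) x w (ee i) i = 0 := by
    intro w
    have a := HasFDerivAt.fun_sum (u := Finset.univ) (fun i _ => hcomp i i)
    have b : (fun y => ∑ i : Fin 3, fderiv ℝ v y (ee i) i) = fun _ => (0:ℝ) :=
      funext hdiv
    rw [b] at a
    have := a.unique (hasFDerivAt_const (0:ℝ) x)
    simpa using congrArg (fun L : E3 →L[ℝ] ℝ => L w) this
  ext j
  have : ∀ i, fderiv ℝ (fderiv ℝ v) x (ee i) (ee i) j
      = fderiv ℝ (fderiv ℝ v) x (ee j) (ee i) i := by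
    intro i
    rw [hsw2 i j, hsymm]
  simp only [WithLp.ofLp_sum, Finset.sum_apply, this, hdv]
  rfl

/-- Maximum principle. -/
lemma max_principle (v : E3 → E3) (hv : ContDiff ℝ 2 v)
    (hdiv : ∀ y, div3 v y = 0) (hvan : Tendsto v (cocompact E3) (𝓝 0)) (M : ℝ) (hM0 : 0 ≤ M)
    (hM : ∀ x ∈ closure {y : E3 | curl3 v y ≠ 0}, ‖v x‖ ≤ M) (x0 : E3) : ‖v x0‖ ≤ M := by
  by_contra hlt
  push Not at hlt
  set e := v x0 with he
  have hepos : 0 < ‖e‖ := hM0.trans_lt hlt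
  obtain ⟨c, hMc, hce⟩ := exists_between hlt
  have hc0 : 0 < c := hM0.trans_lt hMc
  have hev : ∀ᶠ y in cocompact E3, ‖v y‖ < c := by
    have := hvan.norm
    rw [norm_zero] at this
    exact this.eventually_lt_const hc0
  obtain ⟨R0, hR0⟩ : ∃ R, ∀ y, R < ‖y‖ → ‖v y‖ < c := by
    rw [← Metric.cobounded_eq_cocompact] at hev
    obtain ⟨R, -, hR⟩ := (hasBasis_cobounded_norm (E := E3)).eventually_iff.1 hev
    exact ⟨R, fun y hy => hR hy.le⟩
  set R := max (R0 + 1) (‖x0‖ + 1) with hRdef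
  have hR1 : R0 < R := lt_of_lt_of_le (by linarith) (le_max_left _ _)
  have hR2 : ‖x0‖ < R := lt_of_lt_of_le (by linarith) (le_max_right _ _)
  have hRpos : 0 < R := (norm_nonneg _).trans_lt hR2
  obtain ⟨ε, hε, hεR⟩ : ∃ ε > 0, ε * R ^ 2 < ‖e‖ * (‖e‖ - c) := by
    have hp : 0 < ‖e‖ * (‖e‖ - c) := mul_pos hepos (by linarith)
    refine ⟨‖e‖ * (‖e‖ - c) / (2 * R ^ 2), by positivity, ?_⟩
    have : ‖e‖ * (‖e‖ - c) / (2 * R ^ 2) * R ^ 2 = ‖e‖ * (‖e‖ - c) / 2 := by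
      field_simp
    rw [this]; linarith
  set g : E3 → ℝ := fun y => ⟪v y, e⟫ + ε * ⟪y, y⟫ with hg
  have hgc : Continuous g := by
    have := hv.continuous
    fun_prop
  obtain ⟨x1, hx1, hmax⟩ := (isCompact_closedBall (0 : E3) R).exists_isMaxOn
    ⟨x0, by simpa using hR2.le⟩ hgc.continuousOn
  have hx1R : ‖x1‖ ≤ R := by simpa using hx1
  have hg0 : ‖e‖ * ‖e‖ ≤ g x1 := by
    have h1 : g x0 ≤ g x1 := hmax (by simpa using hR2.le)
    have h2 : g x0 = ‖e‖ * ‖e‖ + ε * (‖x0‖ * ‖x0‖) := by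
      simp only [hg, ← he, real_inner_self_eq_norm_mul_norm]
    have h3 : 0 ≤ ε * (‖x0‖ * ‖x0‖) := by positivity
    linarith
  have hvx1 : c < ‖v x1‖ := by
    by_contra hcon
    push Not at hcon
    have h1 : ⟪v x1, e⟫ ≤ c * ‖e‖ :=
      (real_inner_le_norm _ _).trans (mul_le_mul_of_nonneg_right hcon hepos.le)
    have h2 : ε * ⟪x1, x1⟫ ≤ ε * R ^ 2 := by
      rw [real_inner_self_eq_norm_sq]
      gcongr
    have h3 : g x1 = ⟪v x1, e⟫ + ε * ⟪x1, x1⟫ := rfl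
    nlinarith
  have hin : x1 ∈ Metric.ball (0 : E3) R := by
    rw [mem_ball_zero_iff]
    by_contra hcon
    push Not at hcon
    have := hR0 x1 (by linarith)
    linarith
  have hloc : IsLocalMax g x1 :=
    hmax.isLocalMax (Filter.mem_of_superset (Metric.isOpen_ball.mem_nhds hin)
      Metric.ball_subset_closedBall)
  have hnot : x1 ∉ closure {y : E3 | curl3 v y ≠ 0} := fun h => by
    have := hM x1 h
    linarith
  have hcurl : ∀ᶠ y in 𝓝 x1, curl3 v y = 0 := by
    filter_upwards [isClosed_closure.isOpen_compl.mem_nhds hnot] with y hy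
    by_contra hcon
    exact hy (subset_closure hcon)
  have hlap := lap_zero v hv x1 hdiv hcurl
  have hs : ∑ i, (⟪fderiv ℝ (fderiv ℝ v) x1 (ee i) (ee i), e⟫
      + ε * (2 * ⟪ee i, ee i⟫)) ≤ 0 :=
    Finset.sum_nonpos fun i _ => second_dir_le v hv e x1 (ee i) ε hloc
  rw [Finset.sum_add_distrib, ← sum_inner, hlap] at hs
  simp [ee] at hs
  linarith

/-- For a smooth Euler solution (`μ = 0`) with `u` vanishing at spatial
infinity, if `Ω_t ≠ ℝ³` then the sup of `‖u(t,·)‖` over `ℝ³` equals its sup over the closure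
of `ℝ³ \ Ω_t`. -/
theorem euler_sup_eq_sup_on_closure_compl (T : ℝ≥0∞) (hT : 0 < T)
    (u : ℝ → E3 → E3) (p : ℝ → E3 → ℝ)
    (hsol : IsNSSolution 0 T u p)
    (hvan : ∀ t ∈ TimeDom T, Tendsto (u t) (cocompact E3) (𝓝 0))
    (t : ℝ) (ht : t ∈ TimeDom T)
    (hΩ : {y : E3 | curl3 (u t) y = 0} ≠ univ) :
    (⨆ x : E3, ‖u t x‖) = ⨆ x : closure {y : E3 | curl3 (u t) y ≠ 0}, ‖u t x.1‖ := by
  have hv : ContDiff ℝ 2 (u t) := by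
    have h : ContDiff ℝ (⊤ : ℕ∞) (u t) := by
      rw [← contDiffOn_univ]
      have hg : ContDiff ℝ (⊤ : ℕ∞) (fun x : E3 => (t, x)) := by fun_prop
      exact hsol.1.comp hg.contDiffOn (fun x _ => ⟨ht, mem_univ _⟩)
    exact contDiff_infty.1 h 2
  have hva := hvan t ht
  have hbd : BddAbove (range fun x => ‖u t x‖) := by
    have hev : ∀ᶠ y in cocompact E3, ‖u t y‖ < 1 := by
      have := hva.norm
      rw [norm_zero] at this
      exact this.eventually_lt_const one_pos
    obtain ⟨K, hK, hKs⟩ := Filter.mem_cocompact.1 hev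
    obtain ⟨C, hC⟩ := hK.exists_bound_of_continuousOn hv.continuous.continuousOn
    refine ⟨max C 1, ?_⟩
    rintro _ ⟨x, rfl⟩
    by_cases hx : x ∈ K
    · exact (hC x hx).trans (le_max_left _ _)
    · exact (le_of_lt (hKs hx)).trans (le_max_right _ _)
  have hne : Nonempty (closure {y : E3 | curl3 (u t) y ≠ 0}) := by
    obtain ⟨y, hy⟩ := (Set.ne_univ_iff_exists_notMem _).1 hΩ
    exact ⟨⟨y, subset_closure hy⟩⟩
  have hbd2 : BddAbove (range fun x : closure {y : E3 | curl3 (u t) y ≠ 0} => ‖u t x.1‖) :=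
    hbd.mono (by rintro _ ⟨x, rfl⟩; exact ⟨x.1, rfl⟩)
  apply le_antisymm
  · refine ciSup_le fun x0 => ?_
    refine max_principle (u t) hv (hsol.2.2.2 t ht) hva _
      (Real.iSup_nonneg fun _ => norm_nonneg _) (fun x hx => ?_) x0
    exact le_ciSup hbd2 ⟨x, hx⟩
  · exact ciSup_le fun x => le_ciSup hbd x.1
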